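/- arXiv:1104.1859 — 5 statements merged into one kernel-verified Lean document; each statement's English description precedes it below -/
import Mathlib

section
/- Let h ≥ 3 be an odd integer, h' = (h−1)/2, and let G be a finite simple graph on a nonempty vertex set V. In the transformed graph G' (defined in the context), any two distinct vertices of V' \ V (that is, any two distinct vertices among the uᵢ(v) and u₀) are at graph distance at most h − 1 from each other in G'. -/
/-- Vertex set of the transformed graph `G'`: the original vertices `V`, together with
`h'` disjoint copies of `V` (copy `i : Fin h'` corresponds to the nodes `u_{i+1}(v)`),
and one additional vertex `u₀`. -/
def TVert (V : Type*) (h' : ℕ) : Type _ := V ⊕ (Fin h' × V) ⊕ Unit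

/-- The generating relation for the edges of the transformed graph `G'`:
`v — u₁(v)`; `uᵢ(v) — u_{i+1}(v)` for `1 ≤ i < h'`; `u_{h'}(v) — u_{h'}(w)` whenever
`v` and `w` are adjacent in `G`; and `u_{h'}(v) — u₀`. -/
def transRel {V : Type*} (G : SimpleGraph V) (h' : ℕ) :
    TVert V h' → TVert V h' → Prop :=
  fun a b =>
    match a, b with
    | Sum.inl v, Sum.inr (Sum.inl (i, w)) => v = w ∧ (i : ℕ) = 0
    | Sum.inr (Sum.inl (i, v)), Sum.inr (Sum.inl (j, w)) =>
        (v = w ∧ (j : ℕ) = (i : ℕ) + 1) ∨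
          ((i : ℕ) = h' - 1 ∧ (j : ℕ) = h' - 1 ∧ G.Adj v w)
    | Sum.inr (Sum.inl (i, _)), Sum.inr (Sum.inr _) => (i : ℕ) = h' - 1
    | _, _ => False

/-- The transformed graph `G'` on the vertex set `V' = TVert V h'`. -/
def transGraph {V : Type*} (G : SimpleGraph V) (h' : ℕ) : SimpleGraph (TVert V h') :=
  SimpleGraph.fromRel (transRel G h')

/-- A valid `h`-hop coloring of a graph `H`: any two distinct vertices at graph
distance at most `h` receive different colors. -/
def ValidHop {W : Type*} (H : SimpleGraph W) (h : ℕ) {α : Type*} (c : W → α) : Prop :=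
  ∀ u v : W, u ≠ v → H.Reachable u v → H.dist u v ≤ h → c u ≠ c v

/-- Every new vertex has a walk of length at most `n` to `u₀`: climb its column of copies, then
take the edge to `u₀`. -/
theorem exists_walk_to_apex {V : Type*} (G : SimpleGraph V) (n : ℕ) (a : (Fin n × V) ⊕ Unit) :
    ∃ p : (transGraph G n).Walk (Sum.inr a : TVert V n) (Sum.inr (Sum.inr ()) : TVert V n),
      p.length ≤ n := by
  obtain ⟨i, v⟩ | ⟨⟩ := a
  · suffices climb : ∀ k (i : Fin n), (i : ℕ) + k + 1 = n →
        ∃ p : (transGraph G n).Walk (Sum.inr (Sum.inl (i, v)) : TVert V n)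
          (Sum.inr (Sum.inr ()) : TVert V n), p.length = k + 1 by
      obtain ⟨p, hp⟩ := climb (n - 1 - i) i (by omega)
      exact ⟨p, by omega⟩
    intro k
    induction k with
    | zero =>
      intro i hi
      have hadj : (transGraph G n).Adj (Sum.inr (Sum.inl (i, v)) : TVert V n)
          (Sum.inr (Sum.inr ()) : TVert V n) := by
        refine (SimpleGraph.fromRel_adj _ _ _).2 ⟨fun h => ?_, Or.inl ?_⟩
        · cases h
        · change (i : ℕ) = n - 1
          omega
      exact ⟨hadj.toWalk, rfl⟩
    | succ k ih =>
      intro i hi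
      obtain ⟨p, hp⟩ := ih ⟨i + 1, by omega⟩ (by simp only; omega)
      have hadj : (transGraph G n).Adj (Sum.inr (Sum.inl (i, v)) : TVert V n)
          (Sum.inr (Sum.inl (⟨i + 1, by omega⟩, v)) : TVert V n) := by
        refine (SimpleGraph.fromRel_adj _ _ _).2 ⟨fun h => ?_, Or.inl (Or.inl ⟨rfl, rfl⟩)⟩
        have hval := congrArg (fun x : Fin n × V => (x.1 : ℕ)) (Sum.inl.inj (Sum.inr.inj h))
        simp at hval
      exact ⟨.cons hadj p, (SimpleGraph.Walk.length_cons hadj p).trans (congrArg (· + 1) hp)⟩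
  · exact ⟨.nil, Nat.zero_le n⟩

/-- for odd `h ≥ 3` and `h' = (h−1)/2`, any two distinct vertices of
`V' \ V` in the transformed graph `G'` are at graph distance at most `h − 1`. -/
theorem trans_new_vertices_close (h : ℕ) (hh : 3 ≤ h) (hodd : Odd h)
    (V : Type*) [Fintype V] [Nonempty V] (G : SimpleGraph V) :
    ∀ a b : (Fin ((h - 1) / 2) × V) ⊕ Unit, a ≠ b →
      (transGraph G ((h - 1) / 2)).Reachable (Sum.inr a) (Sum.inr b) ∧
        (transGraph G ((h - 1) / 2)).dist (Sum.inr a) (Sum.inr b) ≤ h - 1 := by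
  intro a b _
  obtain ⟨p, hp⟩ := exists_walk_to_apex G ((h - 1) / 2) a
  obtain ⟨q, hq⟩ := exists_walk_to_apex G ((h - 1) / 2) b
  refine ⟨(p.append q.reverse).reachable, (SimpleGraph.dist_le (p.append q.reverse)).trans ?_⟩
  have happend := SimpleGraph.Walk.length_append p q.reverse
  have hreverse := SimpleGraph.Walk.length_reverse q
  omega
end

section
/- Let h ≥ 3 be an odd integer, h' = (h−1)/2, and let G be a finite simple graph on a nonempty vertex set V. In the transformed graph G' (defined in the context), every vertex u ∈ V' \ V and every vertex v ∈ V are at graph distance at most h from each other in G'. Consequently, in any valid h-hop coloring of G', no color used on a vertex of V is used on any vertex of V' \ V. -/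
section TransGraph

variable {V : Type*} (G : SimpleGraph V) {n : ℕ}

/-- The original vertex `v`, as a vertex of the transformed graph. -/
def TVert.original (v : V) : TVert V n := Sum.inl v

/-- A new vertex of the transformed graph. -/
def TVert.new (u : (Fin n × V) ⊕ Unit) : TVert V n := Sum.inr u

/-- The copy of `v` in layer `i`, counted from `0`. -/
abbrev TVert.copy (i : Fin n) (v : V) : TVert V n := TVert.new (Sum.inl (i, v))

/-- The additional vertex joined to the whole last layer. -/
abbrev TVert.apex : TVert V n := TVert.new (Sum.inr ())

theorem transGraph_adj_original_copy (v : V) (hn : 0 < n) :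
    (transGraph G n).Adj (TVert.original v) (TVert.copy ⟨0, hn⟩ v) :=
  ⟨Sum.inl_ne_inr, Or.inl ⟨rfl, rfl⟩⟩

theorem transGraph_adj_copy_succ (v : V) {i : ℕ} (hi : i + 1 < n) :
    (transGraph G n).Adj (TVert.copy ⟨i, i.lt_succ_self.trans hi⟩ v)
      (TVert.copy ⟨i + 1, hi⟩ v) := by
  refine ⟨fun e => ?_, Or.inl (Or.inl ⟨rfl, rfl⟩)⟩
  have := congrArg Prod.fst (Sum.inl.inj (Sum.inr.inj e))
  simp at this

theorem transGraph_adj_copy_apex (v : V) {i : ℕ} (hi : i < n) (hlast : i = n - 1) :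
    (transGraph G n).Adj (TVert.copy ⟨i, hi⟩ v) TVert.apex :=
  ⟨fun e => Sum.inl_ne_inr (Sum.inr.inj e), Or.inl hlast⟩

theorem exists_walk_original_copy (v : V) {i : ℕ} (hi : i < n) :
    ∃ p : (transGraph G n).Walk (TVert.original v) (TVert.copy ⟨i, hi⟩ v),
      p.length = i + 1 := by
  induction i with
  | zero => exact ⟨(transGraph_adj_original_copy G v hi).toWalk, rfl⟩
  | succ i ih =>
    obtain ⟨p, hp⟩ := ih (i.lt_succ_self.trans hi)
    exact ⟨p.concat (transGraph_adj_copy_succ G v hi), by simp [hp]⟩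

theorem exists_walk_original_apex (v : V) (hn : 0 < n) :
    ∃ p : (transGraph G n).Walk (TVert.original v) TVert.apex, p.length = n + 1 := by
  obtain ⟨p, hp⟩ := exists_walk_original_copy G v (Nat.sub_lt hn one_pos)
  refine ⟨p.concat (transGraph_adj_copy_apex G v _ rfl), ?_⟩
  rw [SimpleGraph.Walk.length_concat, hp]
  omega

theorem exists_walk_copy_apex (v : V) {i : ℕ} (hi : i < n) :
    ∃ p : (transGraph G n).Walk (TVert.copy ⟨i, hi⟩ v) TVert.apex,
      p.length = n - i := by
  induction hk : n - 1 - i generalizing i with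
  | zero =>
    refine ⟨(transGraph_adj_copy_apex G v hi (by omega)).toWalk, ?_⟩
    rw [SimpleGraph.Walk.length_cons, SimpleGraph.Walk.length_nil]
    omega
  | succ k ih =>
    obtain ⟨p, hp⟩ := ih (i := i + 1) (by omega) (by omega)
    refine ⟨.cons (transGraph_adj_copy_succ G v (by omega)) p, ?_⟩
    rw [SimpleGraph.Walk.length_cons, hp]
    omega

/-- Every new vertex reaches every original vertex through the apex in at most `2n + 1` steps. -/
theorem exists_walk_new_original (hn : 0 < n) (u : (Fin n × V) ⊕ Unit) (v : V) :
    ∃ p : (transGraph G n).Walk (TVert.new u) (TVert.original v), p.length ≤ 2 * n + 1 := by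
  obtain ⟨q, hq⟩ := exists_walk_original_apex G v hn
  rcases u with ⟨⟨i, hi⟩, w⟩ | ⟨⟩
  · obtain ⟨p, hp⟩ := exists_walk_copy_apex G w hi
    refine ⟨p.append q.reverse, ?_⟩
    rw [SimpleGraph.Walk.length_append, SimpleGraph.Walk.length_reverse, hp, hq]
    omega
  · refine ⟨q.reverse, ?_⟩
    rw [SimpleGraph.Walk.length_reverse, hq]
    omega

end TransGraph

/-- for odd `h ≥ 3` and `h' = (h−1)/2`, every vertex of `V' \ V` and every
vertex of `V` are at graph distance at most `h` in the transformed graph `G'`;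
consequently, in any valid `h`-hop coloring of `G'`, no color used on a vertex of `V`
is used on any vertex of `V' \ V`. -/
theorem trans_old_new_vertices_close (h : ℕ) (hh : 3 ≤ h) (hodd : Odd h)
    (V : Type*) [Fintype V] [Nonempty V] (G : SimpleGraph V) :
    (∀ (u : (Fin ((h - 1) / 2) × V) ⊕ Unit) (v : V),
      (transGraph G ((h - 1) / 2)).Reachable (Sum.inr u) (Sum.inl v) ∧
        (transGraph G ((h - 1) / 2)).dist (Sum.inr u) (Sum.inl v) ≤ h) ∧
    ∀ (α : Type) (c : TVert V ((h - 1) / 2) → α),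
      ValidHop (transGraph G ((h - 1) / 2)) h c →
      ∀ (v : V) (u : (Fin ((h - 1) / 2) × V) ⊕ Unit), c (Sum.inl v) ≠ c (Sum.inr u) := by
  have close : ∀ (u : (Fin ((h - 1) / 2) × V) ⊕ Unit) (v : V),
      (transGraph G ((h - 1) / 2)).Reachable (Sum.inr u) (Sum.inl v) ∧
        (transGraph G ((h - 1) / 2)).dist (Sum.inr u) (Sum.inl v) ≤ h := by
    intro u v
    obtain ⟨p, hp⟩ := exists_walk_new_original G (by omega) u v
    obtain ⟨m, rfl⟩ := hodd
    exact ⟨p.reachable, (SimpleGraph.dist_le p).trans (hp.trans (by omega))⟩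
  refine ⟨close, fun α c hc v u => ?_⟩
  exact (hc _ _ Sum.inr_ne_inl (close u v).1 (close u v).2).symm
end

section
/- Let h ≥ 3 be an odd integer, h' = (h−1)/2, and let G be a finite simple graph on a nonempty vertex set V with n vertices. In any valid h-hop coloring of the transformed graph G' (defined in the context), the colors assigned to the vertices of V' \ V are pairwise distinct; hence exactly h'·n + 1 colors are used on V' \ V, and none of these colors is used on any vertex of V. -/
/-- In an `h`-hop coloring, distinct vertices joined to a common vertex by walks of total length at
most `h` receive different colors. -/
theorem ValidHop.ne_of_walks {W α : Type*} {H : SimpleGraph W} {h : ℕ} {c : W → α}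
    (hc : ValidHop H h c) {u v z : W} (hne : u ≠ v) (p : H.Walk u z) (q : H.Walk v z)
    (hlen : p.length + q.length ≤ h) : c u ≠ c v := by
  refine hc u v hne ⟨p.append q.reverse⟩ ((SimpleGraph.dist_le (p.append q.reverse)).trans ?_)
  simpa using hlen

/-- The copy with zero-based index `i` of a vertex is joined to `u₀` by a walk of length
`h' - i`. -/
theorem transGraph_exists_walk_copy {V : Type*} (G : SimpleGraph V) {h' : ℕ} (v : V)
    (i : Fin h') :
    ∃ p : (transGraph G h').Walk (Sum.inr (Sum.inl (i, v))) (Sum.inr (Sum.inr ())),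
      p.length = h' - i := by
  obtain ⟨k, hk⟩ : ∃ k : ℕ, (i : ℕ) + k + 1 = h' := ⟨h' - i - 1, by omega⟩
  induction k generalizing i with
  | zero =>
    have hadj : (transGraph G h').Adj (Sum.inr (Sum.inl (i, v))) (Sum.inr (Sum.inr ())) := by
      refine (SimpleGraph.fromRel_adj _ _ _).2 ⟨fun h => ?_, Or.inl ?_⟩
      · cases h
      · change (i : ℕ) = h' - 1
        omega
    exact ⟨hadj.toWalk,
      (SimpleGraph.Walk.length_cons hadj .nil).trans (show 0 + 1 = h' - (i : ℕ) by omega)⟩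
  | succ k ih =>
    obtain ⟨p, hp⟩ := ih ⟨i + 1, by omega⟩ (by simp only; omega)
    have hadj : (transGraph G h').Adj (Sum.inr (Sum.inl (i, v)))
        (Sum.inr (Sum.inl (⟨i + 1, by omega⟩, v))) := by
      refine (SimpleGraph.fromRel_adj _ _ _).2 ⟨fun h => ?_, Or.inl (Or.inl ⟨rfl, rfl⟩)⟩
      have := congrArg Fin.val (congrArg Prod.fst (Sum.inl.inj (Sum.inr.inj h)))
      simp at this
    refine ⟨.cons hadj p, (congrArg (· + 1) hp).trans ?_⟩
    simp only
    omega

/-- Every new vertex is joined to `u₀` by a walk of length at most `h'`. -/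
theorem transGraph_exists_walk_inr {V : Type*} (G : SimpleGraph V) {h' : ℕ}
    (a : (Fin h' × V) ⊕ Unit) :
    ∃ p : (transGraph G h').Walk (Sum.inr a) (Sum.inr (Sum.inr ())), p.length ≤ h' := by
  rcases a with ⟨i, v⟩ | ⟨⟩
  · obtain ⟨p, hp⟩ := transGraph_exists_walk_copy G v i
    exact ⟨p, by omega⟩
  · exact ⟨.nil, Nat.zero_le _⟩

/-- Every original vertex is joined to `u₀` by a walk of length `h' + 1`. -/
theorem transGraph_exists_walk_inl {V : Type*} (G : SimpleGraph V) {h' : ℕ} (hpos : 0 < h')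
    (v : V) :
    ∃ p : (transGraph G h').Walk (Sum.inl v) (Sum.inr (Sum.inr ())), p.length = h' + 1 := by
  obtain ⟨p, hp⟩ := transGraph_exists_walk_copy G v ⟨0, hpos⟩
  have hadj : (transGraph G h').Adj (Sum.inl v) (Sum.inr (Sum.inl (⟨0, hpos⟩, v))) := by
    refine (SimpleGraph.fromRel_adj _ _ _).2 ⟨fun h => ?_, Or.inl ⟨rfl, rfl⟩⟩
    cases h
  exact ⟨.cons hadj p, congrArg (· + 1) hp⟩

/-- for odd `h ≥ 3`, `h' = (h−1)/2` and `n = |V|`, in any valid `h`-hop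
coloring of the transformed graph `G'`, the colors of the vertices of `V' \ V` are
pairwise distinct; hence exactly `h'·n + 1` colors are used on `V' \ V`, and none of
these colors is used on any vertex of `V`. -/
theorem trans_new_vertices_colors (h : ℕ) (hh : 3 ≤ h) (hodd : Odd h)
    (V : Type*) [Fintype V] [Nonempty V] (G : SimpleGraph V)
    (α : Type*) (c : TVert V ((h - 1) / 2) → α)
    (hc : ValidHop (transGraph G ((h - 1) / 2)) h c) :
    (∀ a b : (Fin ((h - 1) / 2) × V) ⊕ Unit, a ≠ b → c (Sum.inr a) ≠ c (Sum.inr b)) ∧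
    (Set.range fun a : (Fin ((h - 1) / 2) × V) ⊕ Unit => c (Sum.inr a)).ncard =
      ((h - 1) / 2) * Fintype.card V + 1 ∧
    ∀ (v : V) (a : (Fin ((h - 1) / 2) × V) ⊕ Unit), c (Sum.inl v) ≠ c (Sum.inr a) := by
  have hlen : 2 * ((h - 1) / 2) + 1 = h := by
    obtain ⟨k, rfl⟩ := hodd
    omega
  have hnew : ∀ a b : (Fin ((h - 1) / 2) × V) ⊕ Unit, a ≠ b → c (Sum.inr a) ≠ c (Sum.inr b) := by
    intro a b hab
    obtain ⟨p, hp⟩ := transGraph_exists_walk_inr G a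
    obtain ⟨q, hq⟩ := transGraph_exists_walk_inr G b
    exact hc.ne_of_walks (fun h => hab (Sum.inr.inj h)) p q (by omega)
  refine ⟨hnew, ?_, fun v a => ?_⟩
  · have hinj : Function.Injective fun a : (Fin ((h - 1) / 2) × V) ⊕ Unit => c (Sum.inr a) :=
      fun a b hab => by_contra fun hne => hnew a b hne hab
    rw [← Set.image_univ, Set.ncard_image_of_injective _ hinj, Set.ncard_univ]
    simp
  · obtain ⟨p, hp⟩ := transGraph_exists_walk_inl G (h' := (h - 1) / 2) (by omega) v
    obtain ⟨q, hq⟩ := transGraph_exists_walk_inr G a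
    exact hc.ne_of_walks (fun h => by cases h) p q (by omega)
end

section
/- Let h ≥ 3 be an odd integer, h' = (h−1)/2, and let G be a finite simple graph on a nonempty vertex set V. For any two distinct vertices v, w ∈ V, the graph distance between v and w in the transformed graph G' (defined in the context) is at most h if and only if v and w are adjacent in G; moreover, if v and w are adjacent in G their distance in G' is exactly h, and otherwise it is at least h + 1. -/
open Classical in
/-- The distance from the original vertex `v` in the transformed graph, in closed form. -/
noncomputable def transPotential {V : Type*} (G : SimpleGraph V) (n : ℕ) (v : V) :
    TVert V n → ℕ
  | Sum.inl x => if x = v then 0 else if G.Adj v x then 2 * n + 1 else 2 * n + 2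
  | Sum.inr (Sum.inl (i, x)) =>
      if x = v then i + 1 else if G.Adj v x then 2 * n - i else 2 * n + 1 - i
  | Sum.inr (Sum.inr _) => n + 1

theorem transPotential_lipschitz_of_transRel {V : Type*} {G : SimpleGraph V} {n : ℕ} (v : V)
    {a b : TVert V n} (hab : transRel G n a b) :
    transPotential G n v a ≤ transPotential G n v b + 1 ∧
      transPotential G n v b ≤ transPotential G n v a + 1 := by
  rcases a with x | ⟨i, x⟩ | _ <;> rcases b with y | ⟨j, y⟩ | _ <;>
    simp only [transRel] at hab
  · obtain ⟨rfl, hj⟩ := hab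
    simp only [transPotential]
    split_ifs <;> omega
  · have hi := i.isLt
    have hj := j.isLt
    simp only [transPotential]
    rcases hab with ⟨rfl, hj⟩ | ⟨hi, hj, hxy⟩
    · split_ifs <;> omega
    · by_cases hx : x = v
      · subst hx
        simp only [hxy, hxy.ne', if_true, if_false]
        omega
      · by_cases hy : y = v
        · subst hy
          simp only [hxy.symm, hxy.ne, if_true, if_false]
          omega
        · simp only [hx, hy, if_false]
          split_ifs <;> omega
  · have hi := i.isLt
    simp only [transPotential]
    split_ifs <;> omega

theorem transPotential_le_of_adj {V : Type*} {G : SimpleGraph V} {n : ℕ} (v : V)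
    {a b : TVert V n} (hab : (transGraph G n).Adj a b) :
    transPotential G n v b ≤ transPotential G n v a + 1 := by
  rcases (SimpleGraph.fromRel_adj _ _ _).1 hab with ⟨_, h | h⟩
  · exact (transPotential_lipschitz_of_transRel v h).2
  · exact (transPotential_lipschitz_of_transRel v h).1

theorem transPotential_le_add_length {V : Type*} {G : SimpleGraph V} {n : ℕ} (v : V)
    {a b : TVert V n} (p : (transGraph G n).Walk a b) :
    transPotential G n v b ≤ transPotential G n v a + p.length := by
  induction p with
  | nil => simp
  | cons hab p ih =>
    have := transPotential_le_of_adj v hab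
    rw [SimpleGraph.Walk.length_cons]
    omega

theorem transGraph_adj_of_transRel {V : Type*} {G : SimpleGraph V} {n : ℕ}
    {a b : TVert V n} (hne : a ≠ b) (hab : transRel G n a b) : (transGraph G n).Adj a b :=
  (SimpleGraph.fromRel_adj _ _ _).2 ⟨hne, Or.inl hab⟩

theorem exists_walk_inl_copy {V : Type*} (G : SimpleGraph V) {n : ℕ} (v : V) (i : ℕ)
    (hi : i < n) :
    ∃ p : (transGraph G n).Walk (Sum.inl v) (Sum.inr (Sum.inl (⟨i, hi⟩, v))),
      p.length = i + 1 := by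
  induction i with
  | zero =>
    have hadj : (transGraph G n).Adj (Sum.inl v) (Sum.inr (Sum.inl (⟨0, hi⟩, v))) :=
      transGraph_adj_of_transRel Sum.inl_ne_inr ⟨rfl, rfl⟩
    exact ⟨hadj.toWalk, rfl⟩
  | succ i ih =>
    obtain ⟨p, hp⟩ := ih (by omega)
    have hadj : (transGraph G n).Adj (Sum.inr (Sum.inl (⟨i, by omega⟩, v)))
        (Sum.inr (Sum.inl (⟨i + 1, hi⟩, v))) := by
      refine transGraph_adj_of_transRel (fun he => ?_) (Or.inl ⟨rfl, rfl⟩)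
      have hidx := congrArg Prod.fst (Sum.inl.inj (Sum.inr.inj he))
      simp at hidx
    exact ⟨p.concat hadj, (p.length_concat hadj).trans (congrArg (· + 1) hp)⟩

theorem transGraph_reachable_inl {V : Type*} (G : SimpleGraph V) {n : ℕ} (hn : 0 < n)
    (v w : V) : (transGraph G n).Reachable (Sum.inl v) (Sum.inl w) := by
  have hub (x : V) : (transGraph G n).Reachable (Sum.inl x) (Sum.inr (Sum.inr ())) := by
    obtain ⟨p, -⟩ := exists_walk_inl_copy (n := n) G x (n - 1) (by omega)
    refine p.reachable.trans (transGraph_adj_of_transRel (fun he => ?_) ?_).reachable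
    · exact Sum.inl_ne_inr (Sum.inr.inj he)
    · exact rfl
  exact (hub v).trans (hub w).symm

theorem transGraph_dist_inl_le_of_adj {V : Type*} {G : SimpleGraph V} {n : ℕ} (hn : 0 < n)
    {v w : V} (hvw : G.Adj v w) :
    (transGraph G n).dist (Sum.inl v) (Sum.inl w) ≤ 2 * n + 1 := by
  obtain ⟨p, hp⟩ := exists_walk_inl_copy (n := n) G v (n - 1) (by omega)
  obtain ⟨q, hq⟩ := exists_walk_inl_copy (n := n) G w (n - 1) (by omega)
  have hadj : (transGraph G n).Adj (Sum.inr (Sum.inl (⟨n - 1, by omega⟩, v)))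
      (Sum.inr (Sum.inl (⟨n - 1, by omega⟩, w))) :=
    transGraph_adj_of_transRel
      (fun he => hvw.ne (congrArg Prod.snd (Sum.inl.inj (Sum.inr.inj he))))
      (Or.inr ⟨rfl, rfl, hvw⟩)
  refine (SimpleGraph.dist_le ((p.concat hadj).append q.reverse)).trans ?_
  have happend := (p.concat hadj).length_append q.reverse
  have hconcat := p.length_concat hadj
  have hreverse := q.length_reverse
  omega

theorem transPotential_le_dist {V : Type*} (G : SimpleGraph V) {n : ℕ} (hn : 0 < n)
    (v w : V) :
    transPotential G n v (Sum.inl w) ≤ (transGraph G n).dist (Sum.inl v) (Sum.inl w) := by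
  obtain ⟨p, hp⟩ := (transGraph_reachable_inl G hn v w).exists_walk_length_eq_dist
  have := transPotential_le_add_length v p
  rw [hp] at this
  simpa [transPotential] using this

/-- for odd `h ≥ 3` and `h' = (h−1)/2`, and distinct `v, w ∈ V`, the graph
distance between `v` and `w` in the transformed graph `G'` is at most `h` iff `v` and `w`
are adjacent in `G`; if they are adjacent the distance is exactly `h`, otherwise it is at
least `h + 1`. -/
theorem trans_old_vertices_dist (h : ℕ) (hh : 3 ≤ h) (hodd : Odd h)
    (V : Type*) [Fintype V] [Nonempty V] (G : SimpleGraph V)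
    (v w : V) (hvw : v ≠ w) :
    ((transGraph G ((h - 1) / 2)).dist (Sum.inl v) (Sum.inl w) ≤ h ↔ G.Adj v w) ∧
    (G.Adj v w → (transGraph G ((h - 1) / 2)).dist (Sum.inl v) (Sum.inl w) = h) ∧
    (¬G.Adj v w → h + 1 ≤ (transGraph G ((h - 1) / 2)).dist (Sum.inl v) (Sum.inl w)) := by
  obtain ⟨n, rfl⟩ := hodd
  have hn : 0 < n := by omega
  rw [show (2 * n + 1 - 1) / 2 = n by omega]
  have hlower := transPotential_le_dist G hn v w
  simp only [transPotential, hvw.symm, if_false] at hlower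
  by_cases hadj : G.Adj v w
  · have hupper := transGraph_dist_inl_le_of_adj hn hadj
    simp only [hadj, if_true] at hlower
    exact ⟨iff_of_true hupper hadj, fun _ => le_antisymm hupper hlower, absurd hadj⟩
  · simp only [hadj, if_false] at hlower
    exact ⟨iff_of_false (by omega) hadj, fun h => absurd h hadj, fun _ => hlower⟩
end

section
/- Let h ≥ 3 be an odd integer, h' = (h−1)/2, let G be a finite simple graph on a nonempty vertex set V with n vertices, and let k be a positive integer. Then G admits a proper vertex coloring with k colors (adjacent vertices receive different colors) if and only if the transformed graph G' (defined in the context) admits a valid h-hop coloring with k' = k + h'·n + 1 colors. -/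
namespace TransGraph

variable {V : Type*} (G : SimpleGraph V) {m : ℕ}

/-- The vertices of `G'` that are not vertices of `G`. -/
def fresh (x : (Fin m × V) ⊕ Unit) : TVert V m := Sum.inr x

/-- The vertex `u₀`. -/
def hub : TVert V m := Sum.inr (Sum.inr ())

/-- An original vertex `v`. -/
def leaf (v : V) : TVert V m := Sum.inl v

/-- The copy `u_{i+1}(v)`. -/
def copy (i : Fin m) (v : V) : TVert V m := Sum.inr (Sum.inl (i, v))

lemma adj_leaf_copy (v : V) (i : Fin m) (hi : (i : ℕ) = 0) :
    (transGraph G m).Adj (leaf v) (copy i v) :=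
  ⟨nofun, Or.inl ⟨rfl, hi⟩⟩

lemma adj_copy_succ (v : V) (i j : Fin m) (hij : (j : ℕ) = i + 1) :
    (transGraph G m).Adj (copy i v) (copy j v) := by
  refine ⟨fun h => ?_, Or.inl (Or.inl ⟨rfl, hij⟩)⟩
  have hv := congrArg (fun x : Fin m × V => (x.1 : ℕ)) (Sum.inl.inj (Sum.inr.inj h))
  simp only at hv
  omega

lemma adj_copy_top {v w : V} (hvw : G.Adj v w) (i : Fin m) (hi : (i : ℕ) = m - 1) :
    (transGraph G m).Adj (copy i v) (copy i w) := by
  refine ⟨fun h => ?_, Or.inl (Or.inr ⟨hi, hi, hvw⟩)⟩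
  exact hvw.ne (congrArg Prod.snd (Sum.inl.inj (Sum.inr.inj h)))

lemma adj_copy_hub (v : V) (i : Fin m) (hi : (i : ℕ) = m - 1) :
    (transGraph G m).Adj (copy i v) hub :=
  ⟨nofun, Or.inl hi⟩

lemma exists_walk_leaf_copy (v : V) (i : ℕ) (hi : i < m) :
    ∃ p : (transGraph G m).Walk (leaf v) (copy ⟨i, hi⟩ v), p.length = i + 1 := by
  induction i with
  | zero => exact ⟨(adj_leaf_copy G v ⟨0, hi⟩ rfl).toWalk, rfl⟩
  | succ i ih =>
    obtain ⟨p, hp⟩ := ih (by omega)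
    exact ⟨p.concat (adj_copy_succ G v _ _ rfl), by simp [hp]⟩

lemma exists_walk_copy_hub (v : V) (d : ℕ) (i : Fin m) (hi : i + d + 1 = m) :
    ∃ p : (transGraph G m).Walk (copy i v) hub, p.length = d + 1 := by
  induction d generalizing i with
  | zero => exact ⟨(adj_copy_hub G v i (by omega)).toWalk, rfl⟩
  | succ d ih =>
    obtain ⟨p, hp⟩ := ih ⟨i + 1, by omega⟩ (by simp only; omega)
    exact ⟨p.cons (adj_copy_succ G v _ _ rfl), by simp [hp]⟩

lemma exists_walk_leaf_hub (hm : 1 ≤ m) (v : V) :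
    ∃ p : (transGraph G m).Walk (leaf v) hub, p.length = m + 1 := by
  obtain ⟨p, hp⟩ := exists_walk_copy_hub G v (m - 1) ⟨0, hm⟩ (by simp only; omega)
  exact ⟨p.cons (adj_leaf_copy G v _ rfl), by rw [SimpleGraph.Walk.length_cons, hp]; omega⟩

lemma exists_walk_fresh_hub (x : (Fin m × V) ⊕ Unit) :
    ∃ p : (transGraph G m).Walk (fresh x) hub, p.length ≤ m := by
  rcases x with ⟨i, v⟩ | ⟨⟩
  · obtain ⟨p, hp⟩ := exists_walk_copy_hub G v (m - 1 - i) i (by omega)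
    exact ⟨p, by change p.length ≤ m; omega⟩
  · exact ⟨(SimpleGraph.Walk.nil : (transGraph G m).Walk hub hub), Nat.zero_le m⟩

lemma exists_walk_leaf_leaf (hm : 1 ≤ m) {v w : V} (hvw : G.Adj v w) :
    ∃ p : (transGraph G m).Walk (leaf v) (leaf w), p.length = 2 * m + 1 := by
  obtain ⟨p, hp⟩ := exists_walk_leaf_copy (m := m) G v (m - 1) (by omega)
  obtain ⟨q, hq⟩ := exists_walk_leaf_copy (m := m) G w (m - 1) (by omega)
  refine ⟨(p.concat (adj_copy_top G hvw _ rfl)).append q.reverse, ?_⟩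
  simp only [SimpleGraph.Walk.length_append, SimpleGraph.Walk.length_concat,
    SimpleGraph.Walk.length_reverse, hp, hq]
  omega

open Classical in
/-- A function that is `1`-Lipschitz on `G'` when `v` and `w` are distinct and not adjacent,
and that separates the two original vertices `v` and `w` by `2 * m + 2`. -/
noncomputable def potential (v w : V) : TVert V m → ℤ
  | Sum.inl x => if x = v then 0 else if x = w then 2 * m + 2 else m + 1
  | Sum.inr (Sum.inl (i, x)) =>
    if x = v then i + 1 else if x = w then 2 * m + 1 - i else m + 1
  | Sum.inr (Sum.inr _) => m + 1

lemma abs_potential_sub_le_of_transRel {v w : V} (hvw : ¬ G.Adj v w)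
    {a b : TVert V m} (hab : transRel G m a b) :
    |potential v w a - potential v w b| ≤ 1 := by
  have hwv : ¬ G.Adj w v := fun h => hvw h.symm
  rw [abs_le]
  rcases a with x | ⟨i, x⟩ | _ <;> rcases b with y | ⟨j, y⟩ | _ <;>
    simp only [transRel] at hab
  · obtain ⟨rfl, hj⟩ := hab
    simp only [potential]
    split_ifs <;> omega
  · have := i.2
    rcases hab with ⟨rfl, hj⟩ | ⟨hi, hj, hxy⟩
    · simp only [potential]
      split_ifs <;> omega
    · simp only [potential]
      split_ifs <;> subst_vars <;> first | omega | contradiction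
  · have := i.2
    simp only [potential]
    split_ifs <;> omega

lemma potential_sub_le_length {v w : V} (hvw : ¬ G.Adj v w) {a b : TVert V m}
    (p : (transGraph G m).Walk a b) :
    potential v w b - potential v w a ≤ p.length := by
  induction p with
  | nil => simp
  | @cons a b c hab p ih =>
    have h : |potential v w a - potential v w b| ≤ 1 := by
      rcases hab.2 with h | h
      · exact abs_potential_sub_le_of_transRel G hvw h
      · rw [abs_sub_comm]
        exact abs_potential_sub_le_of_transRel G hvw h
    rw [abs_le] at h
    rw [SimpleGraph.Walk.length_cons]
    push_cast
    omega

lemma adj_of_length_le {v w : V} (hne : v ≠ w)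
    (p : (transGraph G m).Walk (leaf v) (leaf w)) (hp : p.length ≤ 2 * m + 1) :
    G.Adj v w := by
  by_contra hvw
  have h := potential_sub_le_length G hvw p
  have hv : potential v w (leaf v : TVert V m) = 0 := if_pos rfl
  have hw : potential v w (leaf w : TVert V m) = 2 * m + 2 :=
    (if_neg hne.symm).trans (if_pos rfl)
  omega

lemma ne_of_walk {W α : Type*} {H : SimpleGraph W} {h : ℕ} {c : W → α} (hc : ValidHop H h c)
    {u v : W} (hne : u ≠ v) (p : H.Walk u v) (hp : p.length ≤ h) : c u ≠ c v :=
  hc u v hne p.reachable ((SimpleGraph.dist_le p).trans hp)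

lemma exists_validHop_of_coloring [Fintype V] {k : ℕ} (c : V → Fin k)
    (hc : ∀ v w, G.Adj v w → c v ≠ c w) :
    ∃ c' : TVert V m → Fin (k + m * Fintype.card V + 1),
      ValidHop (transGraph G m) (2 * m + 1) c' := by
  have e : (Fin m × V) ⊕ Unit ≃ Fin (m * Fintype.card V + 1) :=
    Fintype.equivFinOfCardEq (by simp)
  refine ⟨fun x => (finSumFinEquiv (Sum.map c e x) : Fin (k + (m * Fintype.card V + 1))), ?_⟩
  intro a b hab hreach hdist heq
  have heq' : Sum.map c e a = Sum.map c e b := finSumFinEquiv.injective heq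
  obtain ⟨p, hp⟩ := hreach.exists_walk_length_eq_dist
  rcases a with v | x <;> rcases b with w | y
  · have hne : v ≠ w := fun h => hab (h ▸ rfl)
    exact hc v w (adj_of_length_le G hne p (hp ▸ hdist)) (Sum.inl.inj heq')
  · exact Sum.inl_ne_inr heq'
  · exact Sum.inr_ne_inl heq'
  · exact hab (congrArg Sum.inr (e.injective (Sum.inr.inj heq')))

lemma exists_coloring_of_validHop [Fintype V] (hm : 1 ≤ m) {k : ℕ}
    (c' : TVert V m → Fin (k + m * Fintype.card V + 1))
    (hc' : ValidHop (transGraph G m) (2 * m + 1) c') :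
    ∃ c : V → Fin k, ∀ v w, G.Adj v w → c v ≠ c w := by
  classical
  let f : (Fin m × V) ⊕ Unit → Fin (k + m * Fintype.card V + 1) := fun x => c' (fresh x)
  have hf : Function.Injective f := by
    intro x y hxy
    by_contra hne
    obtain ⟨p, hp⟩ := exists_walk_fresh_hub G x
    obtain ⟨q, hq⟩ := exists_walk_fresh_hub G y
    refine ne_of_walk hc' (u := fresh x) (v := fresh y) (fun h => hne (Sum.inr.inj h))
      (p.append q.reverse) ?_ hxy
    rw [SimpleGraph.Walk.length_append, SimpleGraph.Walk.length_reverse]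
    omega
  have hleaf (v : V) : c' (leaf v) ∈ (Finset.univ.image f)ᶜ := by
    simp only [Finset.mem_compl, Finset.mem_image, Finset.mem_univ, true_and, not_exists]
    intro x hx
    obtain ⟨p, hp⟩ := exists_walk_fresh_hub G x
    obtain ⟨q, hq⟩ := exists_walk_leaf_hub G hm v
    refine ne_of_walk hc' (u := fresh x) (v := leaf v) Sum.inr_ne_inl (p.append q.reverse) ?_ hx
    rw [SimpleGraph.Walk.length_append, SimpleGraph.Walk.length_reverse]
    omega
  have hcard : (Finset.univ.image f)ᶜ.card = k := by
    rw [Finset.card_compl, Finset.card_image_of_injective _ hf]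
    simp only [Fintype.card_fin, Finset.card_univ, Fintype.card_sum, Fintype.card_prod,
      Fintype.card_unit]
    omega
  refine ⟨fun v => Finset.equivFinOfCardEq hcard ⟨c' (leaf v), hleaf v⟩, ?_⟩
  intro v w hvw heq
  obtain ⟨p, hp⟩ := exists_walk_leaf_leaf G hm hvw
  exact ne_of_walk hc' (fun h => hvw.ne (Sum.inl.inj h)) p hp.le
    (congrArg Subtype.val ((Finset.equivFinOfCardEq hcard).injective heq))

end TransGraph

/-- for odd `h ≥ 3`, `h' = (h−1)/2`, `n = |V|` and `k ≥ 1`, the graph `G`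
admits a proper vertex coloring with `k` colors iff the transformed graph `G'` admits a
valid `h`-hop coloring with `k' = k + h'·n + 1` colors. -/
theorem trans_coloring_equivalence (h : ℕ) (hh : 3 ≤ h) (hodd : Odd h)
    (V : Type*) [Fintype V] [Nonempty V] (G : SimpleGraph V) (k : ℕ) (hk : 1 ≤ k) :
    (∃ c : V → Fin k, ∀ v w : V, G.Adj v w → c v ≠ c w) ↔
      ∃ c' : TVert V ((h - 1) / 2) → Fin (k + ((h - 1) / 2) * Fintype.card V + 1),
        ValidHop (transGraph G ((h - 1) / 2)) h c' := by
  obtain ⟨m, rfl⟩ := hodd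
  have hm : (2 * m + 1 - 1) / 2 = m := by omega
  rw [hm]
  exact ⟨fun ⟨c, hc⟩ => TransGraph.exists_validHop_of_coloring G c hc,
    fun ⟨c', hc'⟩ => TransGraph.exists_coloring_of_validHop G (by omega) c' hc'⟩
end
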